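/- arXiv:2207.12584 — 2 statements merged into one kernel-verified Lean document; each statement's English description precedes it below -/
import Mathlib

section
/- Let 3 ≤ k ≤ n−2, and let Δ = {v ∈ F_q^n : H(k)vᵀ = c·φ_k(P) for some P ∈ E(F_q)∖D and some nonzero c ∈ F_q}. Then Δ has exactly (|E(F_q)|−n)·(q−1)·q^{n−k} elements; moreover, if the covering radius of C_Ω(D,kO) equals k−1, then every element of Δ is a deep hole of C_Ω(D,kO). (In particular, for distinct points P ≠ Q of E(F_q) the corresponding syndrome cosets are disjoint.) -/
open Matrix BigOperators

/-- Values of the `k` monomials `x^i y^j` (`j ∈ {0,1}`, `2i+3j ≤ k`), a basis of the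
Riemann–Roch space `L(kO)`, at an affine point `P = (α, β)`:
`(1, α, …, α^⌊k/2⌋, β, αβ, …, α^⌊(k−3)/2⌋ β)`. -/
def phiAff {F : Type*} [Field F] (k : ℕ) (P : F × F) : Fin k → F :=
  fun j => if (j : ℕ) ≤ k / 2 then P.1 ^ (j : ℕ) else P.2 * P.1 ^ ((j : ℕ) - k / 2 - 1)

/-- The vector `φ_k(O)` attached to the point at infinity: the standard unit vector supported
at the coordinate of `x^{k/2}` (`k` even) resp. `x^{(k-3)/2} y` (`k` odd). -/
def phiInf (F : Type*) [Field F] (k : ℕ) : Fin k → F :=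
  fun j => if (j : ℕ) = (if k % 2 = 0 then k / 2 else k - 1) then 1 else 0

/-- The parity-check matrix `H(k)` with columns `φ_k(P_1), …, φ_k(P_n)`. -/
def Hmat {F : Type*} [Field F] {n : ℕ} (k : ℕ) (P : Fin n → F × F) :
    Matrix (Fin k) (Fin n) F := fun i j => phiAff k (P j) i

/-- The functional elliptic code `C_L(D, kO)`: the row space of `H(k)`. -/
def funcCode {F : Type*} [Field F] {n : ℕ} (k : ℕ) (P : Fin n → F × F) :
    Set (Fin n → F) := {v | ∃ u : Fin k → F, v = Matrix.vecMul u (Hmat k P)}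

/-- The residue elliptic code `C_Ω(D, kO) = {v : H(k) vᵀ = 0}`. -/
def resCode {F : Type*} [Field F] {n : ℕ} (k : ℕ) (P : Fin n → F × F) :
    Set (Fin n → F) := {v | Matrix.mulVec (Hmat k P) v = 0}

/-- Error distance `d(v, C)` from a word to a code. -/
noncomputable def dTo {F : Type*} [DecidableEq F] {n : ℕ} (v : Fin n → F) (C : Set (Fin n → F)) : ℕ :=
  sInf (hammingDist v '' C)

/-- Covering radius `ρ(C) = max_v d(v, C)`. -/
noncomputable def covRad {F : Type*} [DecidableEq F] {n : ℕ} (C : Set (Fin n → F)) : ℕ :=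
  sSup (Set.range fun v : Fin n → F => dTo v C)

/-- Minimum distance: the least Hamming weight of a nonzero codeword. -/
noncomputable def minDist {F : Type*} [DecidableEq F] [Zero F] {n : ℕ} (C : Set (Fin n → F)) : ℕ :=
  sInf ((fun c => hammingDist c 0) '' (C \ {0}))

/-- Dimension of a code (as the dimension of its linear span). -/
noncomputable def dimCode (F : Type*) [Field F] {n : ℕ} (C : Set (Fin n → F)) : ℕ :=
  Module.finrank F (Submodule.span F C)

/-- `(α, β)` is an affine rational point of the curve `y² = x³ + s x + t`. -/
def onCurve {F : Type*} [Field F] (s t : F) (P : F × F) : Prop :=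
  P.2 ^ 2 = P.1 ^ 3 + s * P.1 + t

/-- The number `|E(F_q)|` of rational points: affine points plus the point at infinity. -/
def numPoints (F : Type*) [Field F] [Fintype F] [DecidableEq F] (s t : F) : ℕ :=
  (Finset.univ.filter (fun P : F × F => P.2 ^ 2 = P.1 ^ 3 + s * P.1 + t)).card + 1

open Polynomial

namespace WeierstrassCurve.Affine.CoordinateRing

variable {F : Type*} [Field F] {W : WeierstrassCurve.Affine F}

/-- Evaluation of regular functions at an affine point of a Weierstrass curve. -/
noncomputable def evalAt {Q : F × F} (h : W.Equation Q.1 Q.2) : W.CoordinateRing →ₐ[F] F :=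
  { AdjoinRoot.evalEval h with
    commutes' := fun c => (AdjoinRoot.evalEval_mk h (C (C c))).trans (evalEval_CC _ _ c) }

lemma evalAt_mk {Q : F × F} (h : W.Equation Q.1 Q.2) (g : F[X][X]) :
    evalAt h (mk W g) = g.evalEval Q.1 Q.2 :=
  AdjoinRoot.evalEval_mk h g

/-- Evaluations at distinct points vanishing at `f` are linearly independent functionals on the
quotient by `f`. -/
lemma linearIndependent_evalAt {ι : Type*} {pt : ι → F × F} (hinj : Function.Injective pt)
    (hpt : ∀ i, W.Equation (pt i).1 (pt i).2) {f : W.CoordinateRing}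
    (hf : ∀ a ∈ Ideal.span {f}, ∀ i, evalAt (hpt i) a = 0) :
    LinearIndependent F (fun i => (Ideal.Quotient.liftₐ (Ideal.span {f}) (evalAt (hpt i))
      (fun a ha => hf a ha i)).toLinearMap) := by
  refine (linearIndependent_toLinearMap F (W.CoordinateRing ⧸ Ideal.span {f}) F).comp
    (fun i => Ideal.Quotient.liftₐ (Ideal.span {f}) (evalAt (hpt i)) fun a ha => hf a ha i)
    fun i j hij => hinj ?_
  have key : ∀ g : F[X][X], g.evalEval (pt i).1 (pt i).2 = g.evalEval (pt j).1 (pt j).2 := by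
    intro g
    rw [← evalAt_mk (hpt i), ← evalAt_mk (hpt j)]
    exact DFunLike.congr_fun hij (Ideal.Quotient.mk _ (mk W g))
  ext
  · simpa only [evalEval_C, eval_X] using key (C X)
  · simpa only [evalEval_X] using key X

variable {ι : Type*} [Fintype ι] {pt : ι → F × F}

lemma evalAt_eq_zero_of_mem_span {Q : F × F} (h : W.Equation Q.1 Q.2) {f a : W.CoordinateRing}
    (hf : evalAt h f = 0) (ha : a ∈ Ideal.span {f}) : evalAt h a = 0 := by
  obtain ⟨b, rfl⟩ := Ideal.mem_span_singleton'.mp ha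
  rw [map_mul, hf, mul_zero]

lemma finiteDimensional_quotient_span_singleton {f : W.CoordinateRing} (hf : f ≠ 0) :
    FiniteDimensional F (W.CoordinateRing ⧸ Ideal.span {f}) :=
  Module.Finite.equiv (Ideal.quotientEquivDirectSum F (CoordinateRing.basis W)
    (Ideal.span_singleton_eq_bot.not.mpr hf)).symm

/-- A nonzero regular function has at most as many zeros as its pole order at infinity. -/
lemma card_le_natDegree_norm (hinj : Function.Injective pt)
    (hpt : ∀ i, W.Equation (pt i).1 (pt i).2) {f : W.CoordinateRing} (hf0 : f ≠ 0)
    (hf : ∀ i, evalAt (hpt i) f = 0) :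
    Fintype.card ι ≤ (Algebra.norm F[X] f).natDegree := by
  have hfin : FiniteDimensional F (W.CoordinateRing ⧸ Ideal.span {f}) :=
    finiteDimensional_quotient_span_singleton hf0
  rw [← finrank_quotient_span_eq_natDegree_norm (CoordinateRing.basis W) hf0,
    ← Subspace.dual_finrank_eq]
  exact (linearIndependent_evalAt hinj hpt
    fun a ha i => evalAt_eq_zero_of_mem_span (hpt i) (hf i) ha).fintype_card_le_finrank

/-- A function with exactly as many zeros as its pole order divides every function
vanishing at these zeros. -/
lemma dvd_of_natDegree_norm_le_card (hinj : Function.Injective pt)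
    (hpt : ∀ i, W.Equation (pt i).1 (pt i).2) {f g : W.CoordinateRing} (hf0 : f ≠ 0)
    (hf : ∀ i, evalAt (hpt i) f = 0) (hfd : (Algebra.norm F[X] f).natDegree ≤ Fintype.card ι)
    (hg : ∀ i, evalAt (hpt i) g = 0) : f ∣ g := by
  have hfin : FiniteDimensional F (W.CoordinateRing ⧸ Ideal.span {f}) :=
    finiteDimensional_quotient_span_singleton hf0
  have hli := linearIndependent_evalAt hinj hpt
    fun a ha i => evalAt_eq_zero_of_mem_span (hpt i) (hf i) ha
  have hspan := hli.span_eq_top_of_card_eq_finrank' (by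
    rw [Subspace.dual_finrank_eq,
      finrank_quotient_span_eq_natDegree_norm (CoordinateRing.basis W) hf0]
    exact (card_le_natDegree_norm hinj hpt hf0 hf).antisymm hfd)
  rw [← Ideal.mem_span_singleton, ← Ideal.Quotient.eq_zero_iff_mem,
    ← Module.forall_dual_apply_eq_zero_iff F]
  intro φ
  have hφ : φ ∈ (⊤ : Submodule F (Module.Dual F (W.CoordinateRing ⧸ Ideal.span {f}))) := trivial
  rw [← hspan] at hφ
  induction hφ using Submodule.span_induction with
  | mem φ h => obtain ⟨i, rfl⟩ := h; exact hg i
  | zero => rfl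
  | add φ ψ _ _ h₁ h₂ => rw [LinearMap.add_apply, h₁, h₂, add_zero]
  | smul c φ _ h => rw [LinearMap.smul_apply, h, smul_zero]

lemma exists_eq_algebraMap_of_natDegree_norm_le_one {f : W.CoordinateRing}
    (hf : (Algebra.norm F[X] f).natDegree ≤ 1) : ∃ c : F, f = algebraMap F _ c := by
  obtain ⟨p, q, rfl⟩ := exists_smul_basis_eq f
  have h0 : (Algebra.norm F[X] (p • (1 : W.CoordinateRing) + q • mk W X)).natDegree ≤ 0 := by
    have := natDegree_norm_ne_one (p • (1 : W.CoordinateRing) + q • mk W X)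
    omega
  rw [natDegree_le_iff_degree_le, degree_norm_smul_basis, max_le_iff] at h0
  have hq : q = 0 := by
    by_contra hq
    have := h0.2
    rw [degree_eq_natDegree hq, nsmul_eq_mul] at this
    have : 2 * q.natDegree + 3 ≤ 0 := by exact_mod_cast this
    omega
  have hp : p.natDegree = 0 := by
    by_cases hp : p = 0
    · simp [hp]
    have := h0.1
    rw [degree_eq_natDegree hp, nsmul_eq_mul] at this
    have : 2 * p.natDegree ≤ 0 := by exact_mod_cast this
    omega
  obtain ⟨c, rfl⟩ := natDegree_eq_zero.mp hp
  refine ⟨c, ?_⟩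
  rw [hq, zero_smul, add_zero, smul, mul_one]
  rfl

/-- If the pole order of `f` equals its number of prescribed zeros, every function with the same
zeros and at most one more pole is a constant multiple of `f`. -/
lemma exists_smul_eq_of_natDegree_norm_le (hinj : Function.Injective pt)
    (hpt : ∀ i, W.Equation (pt i).1 (pt i).2) {f g : W.CoordinateRing} (hf0 : f ≠ 0)
    (hf : ∀ i, evalAt (hpt i) f = 0) (hfd : (Algebra.norm F[X] f).natDegree ≤ Fintype.card ι)
    (hg : ∀ i, evalAt (hpt i) g = 0)
    (hgd : (Algebra.norm F[X] g).natDegree ≤ Fintype.card ι + 1) : ∃ c : F, g = c • f := by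
  obtain ⟨w, rfl⟩ := dvd_of_natDegree_norm_le_card hinj hpt hf0 hf hfd hg
  obtain rfl | hw := eq_or_ne w 0
  · exact ⟨0, by simp⟩
  obtain ⟨c, rfl⟩ := exists_eq_algebraMap_of_natDegree_norm_le_one (f := w) (by
    have hnf := Algebra.norm_ne_zero_iff_of_basis (CoordinateRing.basis W) |>.mpr hf0
    have hnw := Algebra.norm_ne_zero_iff_of_basis (CoordinateRing.basis W) |>.mpr hw
    rw [map_mul, natDegree_mul hnf hnw] at hgd
    have := card_le_natDegree_norm hinj hpt hf0 hf
    omega)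
  exact ⟨c, by rw [Algebra.smul_def, mul_comm]⟩

lemma natDegree_norm_smul_basis_le {p q : F[X]} {m : ℕ} (hp : 2 * p.natDegree ≤ m)
    (hq : q ≠ 0 → 2 * q.natDegree + 3 ≤ m) :
    (Algebra.norm F[X] (p • (1 : W.CoordinateRing) + q • mk W X)).natDegree ≤ m := by
  rw [natDegree_le_iff_degree_le, degree_norm_smul_basis, max_le_iff]
  constructor
  · by_cases hp0 : p = 0
    · simp [hp0]
    · rw [degree_eq_natDegree hp0, nsmul_eq_mul]
      exact_mod_cast hp
  · by_cases hq0 : q = 0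
    · simp [hq0]
    · rw [degree_eq_natDegree hq0, nsmul_eq_mul]
      exact_mod_cast hq hq0

end WeierstrassCurve.Affine.CoordinateRing

namespace EllipticCode

open WeierstrassCurve.Affine CoordinateRing

variable {F : Type*} [Field F] {W : WeierstrassCurve.Affine F} {k : ℕ}

/-- The pole order at infinity of the `j`-th monomial. -/
def poleOrder (k j : ℕ) : ℕ := if j ≤ k / 2 then 2 * j else 2 * (j - k / 2 - 1) + 3

/-- The coefficient of `1` in the `j`-th monomial. -/
noncomputable def xPart (F : Type*) [Field F] (k j : ℕ) : F[X] := if j ≤ k / 2 then X ^ j else 0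

/-- The coefficient of `y` in the `j`-th monomial. -/
noncomputable def yPart (F : Type*) [Field F] (k j : ℕ) : F[X] :=
  if j ≤ k / 2 then 0 else X ^ (j - k / 2 - 1)

/-- The regular function with given coordinates in the monomial basis of `L(kO)`. -/
noncomputable def toFunction (W : WeierstrassCurve.Affine F) (k : ℕ) :
    (Fin k → F) →ₗ[F] W.CoordinateRing :=
  Fintype.linearCombination F fun j : Fin k =>
    xPart F k j • (1 : W.CoordinateRing) + yPart F k j • mk W X

lemma toFunction_apply (u : Fin k → F) :
    toFunction W k u = (∑ j, u j • xPart F k j) • (1 : W.CoordinateRing) +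
      (∑ j, u j • yPart F k j) • mk W X := by
  simp only [toFunction, Fintype.linearCombination_apply, smul_add, Finset.sum_add_distrib,
    Finset.sum_smul, smul_assoc]

lemma evalAt_toFunction {Q : F × F} (h : W.Equation Q.1 Q.2) (u : Fin k → F) :
    evalAt h (toFunction W k u) = u ⬝ᵥ phiAff k Q := by
  simp only [toFunction, Fintype.linearCombination_apply, map_sum, map_smul, smul_eq_mul,
    dotProduct]
  refine Finset.sum_congr rfl fun j _ => ?_
  rw [CoordinateRing.smul, CoordinateRing.smul, mul_one, ← map_mul, ← map_add, evalAt_mk,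
    xPart, yPart, phiAff]
  split_ifs <;> simp [mul_comm, evalEval_C]

lemma toFunction_injective : Function.Injective (toFunction W k) := by
  rw [injective_iff_map_eq_zero]
  intro u hu
  rw [toFunction_apply] at hu
  obtain ⟨hp, hq⟩ := smul_basis_eq_zero hu
  ext j
  by_cases hj : (j : ℕ) ≤ k / 2
  · have := congrArg (coeff · (j : ℕ)) hp
    simp only [finsetSum_coeff, coeff_smul, coeff_zero, smul_eq_mul] at this
    rw [Finset.sum_eq_single j] at this
    · simpa [xPart, hj] using this
    · intro i _ hij
      rw [xPart]
      split_ifs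
      · rw [coeff_X_pow, if_neg (fun h => hij (Fin.ext h.symm)), mul_zero]
      · simp
    · simp
  · have := congrArg (coeff · ((j : ℕ) - k / 2 - 1)) hq
    simp only [finsetSum_coeff, coeff_smul, coeff_zero, smul_eq_mul] at this
    rw [Finset.sum_eq_single j] at this
    · simpa [yPart, hj] using this
    · intro i _ hij
      rw [yPart]
      split_ifs
      · simp
      · rw [coeff_X_pow, if_neg (fun h => hij (Fin.ext (by omega))), mul_zero]
    · simp

lemma natDegree_norm_toFunction_le {u : Fin k → F} {m : ℕ}
    (hu : ∀ j, u j ≠ 0 → poleOrder k j ≤ m) :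
    (Algebra.norm F[X] (toFunction W k u)).natDegree ≤ m := by
  rw [toFunction_apply]
  refine natDegree_norm_smul_basis_le ?_ fun hq => ?_
  · suffices (∑ j, u j • xPart F k j).natDegree ≤ m / 2 by omega
    refine natDegree_sum_le_of_forall_le _ _ fun j _ => ?_
    by_cases hj : u j = 0
    · simp [hj]
    refine (natDegree_smul_le _ _).trans ?_
    have := hu j hj
    rw [poleOrder] at this
    rw [xPart]
    split_ifs at this ⊢
    · rw [natDegree_X_pow]; omega
    · simp
  · have hm : 3 ≤ m := by
      by_contra hm
      refine hq (Finset.sum_eq_zero fun j _ => ?_)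
      by_cases hj : u j = 0
      · simp [hj]
      have := hu j hj
      rw [poleOrder] at this
      rw [yPart]
      split_ifs at this ⊢
      · simp
      · omega
    suffices (∑ j, u j • yPart F k j).natDegree ≤ (m - 3) / 2 by omega
    refine natDegree_sum_le_of_forall_le _ _ fun j _ => ?_
    by_cases hj : u j = 0
    · simp [hj]
    refine (natDegree_smul_le _ _).trans ?_
    have := hu j hj
    rw [poleOrder] at this
    rw [yPart]
    split_ifs at this ⊢
    · simp
    · rw [natDegree_X_pow]; omega

lemma poleOrder_le (j : Fin k) : poleOrder k j ≤ k := by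
  have := j.isLt
  rw [poleOrder]
  split_ifs <;> omega

/-- The index of the monomial of pole order `k`. -/
def topIndex (k : ℕ) : ℕ := if k % 2 = 0 then k / 2 else k - 1

/-- The index of the monomial of pole order `k - 1`. -/
def subtopIndex (k : ℕ) : ℕ := if k % 2 = 0 then k - 1 else k / 2

lemma topIndex_lt (hk : 3 ≤ k) : topIndex k < k := by
  rw [topIndex]
  split_ifs <;> omega

lemma subtopIndex_lt (hk : 3 ≤ k) : subtopIndex k < k := by
  rw [subtopIndex]
  split_ifs <;> omega

lemma poleOrder_lt {j : Fin k} (hj : (j : ℕ) ≠ topIndex k) : poleOrder k j + 1 ≤ k := by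
  have := j.isLt
  rw [poleOrder]
  rw [topIndex] at hj
  split_ifs at hj ⊢ <;> omega

lemma poleOrder_add_two_le (hk : 3 ≤ k) {j : Fin k} (hj : (j : ℕ) ≠ topIndex k)
    (hj' : (j : ℕ) ≠ subtopIndex k) : poleOrder k j + 2 ≤ k := by
  have := j.isLt
  rw [poleOrder]
  rw [topIndex] at hj
  rw [subtopIndex] at hj'
  split_ifs at hj hj' ⊢ <;> omega

lemma dotProduct_phiInf (hk : 3 ≤ k) (u : Fin k → F) :
    u ⬝ᵥ phiInf F k = u ⟨topIndex k, topIndex_lt hk⟩ := by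
  rw [dotProduct, Finset.sum_eq_single ⟨topIndex k, topIndex_lt hk⟩]
  · simp [phiInf, topIndex]
  · intro j _ hj
    exact mul_eq_zero_of_right _ (if_neg fun h => hj (Fin.ext h))
  · simp

section Orthogonal

variable {ι : Type*} [Fintype ι]

lemma exists_ne_zero_forall_dotProduct_eq_zero (w : ι → Fin k → F) (hι : Fintype.card ι < k) :
    ∃ u : Fin k → F, u ≠ 0 ∧ ∀ i, u ⬝ᵥ w i = 0 := by
  have h := (Matrix.mulVecLin (Matrix.of w)).ker_ne_bot_of_finrank_lt (by simpa using hι)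
  obtain ⟨u, hu, hu0⟩ := Submodule.exists_mem_ne_zero_of_ne_bot h
  refine ⟨u, hu0, fun i => ?_⟩
  rw [dotProduct_comm]
  exact congrFun hu i

/-- The orthogonal complement of at most `k - 2` vectors is at least two-dimensional. -/
lemma exists_pair_forall_dotProduct_eq_zero (w : ι → Fin k → F) (hι : Fintype.card ι + 1 < k)
    (j₀ : Fin k) : ∃ h f : Fin k → F, h ≠ 0 ∧ h j₀ = 0 ∧ (∀ c : F, f ≠ c • h) ∧
      (∀ i, h ⬝ᵥ w i = 0) ∧ ∀ i, f ⬝ᵥ w i = 0 := by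
  have key : ∀ j : Fin k, ∃ u : Fin k → F, u ≠ 0 ∧ u j = 0 ∧ ∀ i, u ⬝ᵥ w i = 0 := by
    intro j
    obtain ⟨u, hu0, hu⟩ := exists_ne_zero_forall_dotProduct_eq_zero
      (fun o : Option ι => o.elim (Pi.single j 1) w) (by simpa using hι)
    exact ⟨u, hu0, by simpa using hu none, fun i => hu (some i)⟩
  obtain ⟨h, h0, hj₀, hw⟩ := key j₀
  obtain ⟨j, hj⟩ := Function.ne_iff.mp h0
  obtain ⟨f, f0, hfj, hfw⟩ := key j
  refine ⟨h, f, h0, hj₀, fun c hc => f0 ?_, hw, hfw⟩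
  have hc0 : c = 0 := by
    rw [hc] at hfj
    exact (mul_eq_zero.mp hfj).resolve_right hj
  rw [hc, hc0, zero_smul]

variable {pt : ι → F × F}

lemma eq_zero_of_forall_dotProduct_phiAff_eq_zero (hinj : Function.Injective pt)
    (hpt : ∀ i, W.Equation (pt i).1 (pt i).2) (hι : k < Fintype.card ι) {u : Fin k → F}
    (hu : ∀ i, u ⬝ᵥ phiAff k (pt i) = 0) : u = 0 := by
  by_contra hu0
  have h := card_le_natDegree_norm hinj hpt
    ((map_ne_zero_iff _ toFunction_injective).mpr hu0 : toFunction W k u ≠ 0)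
    fun i => by rw [evalAt_toFunction, hu]
  have := natDegree_norm_toFunction_le (W := W) (u := u) fun j _ => poleOrder_le j
  omega

lemma exists_eq_smul_of_poleOrder_le (hinj : Function.Injective pt)
    (hpt : ∀ i, W.Equation (pt i).1 (pt i).2) {h f : Fin k → F} (h0 : h ≠ 0)
    (hh : ∀ i, h ⬝ᵥ phiAff k (pt i) = 0) (hf : ∀ i, f ⬝ᵥ phiAff k (pt i) = 0)
    (hhd : ∀ j, h j ≠ 0 → poleOrder k j ≤ Fintype.card ι)
    (hfd : ∀ j, f j ≠ 0 → poleOrder k j ≤ Fintype.card ι + 1) : ∃ c : F, f = c • h := by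
  obtain ⟨c, hc⟩ := exists_smul_eq_of_natDegree_norm_le hinj hpt
    ((map_ne_zero_iff _ toFunction_injective).mpr h0 : toFunction W k h ≠ 0)
    (fun i => by rw [evalAt_toFunction, hh]) (natDegree_norm_toFunction_le hhd)
    (fun i => by rw [evalAt_toFunction, hf]) (natDegree_norm_toFunction_le hfd)
  exact ⟨c, toFunction_injective (hc.trans (map_smul _ _ _).symm)⟩

/-- `k - 2` affine points can be separated from any further affine point by a function
of pole order at most `k`. -/
lemma exists_dotProduct_phiAff_ne_zero (hinj : Function.Injective pt)
    (hpt : ∀ i, W.Equation (pt i).1 (pt i).2) (hk : 3 ≤ k) (hι : Fintype.card ι + 2 = k)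
    {Q : F × F} (hQ : W.Equation Q.1 Q.2) (hQpt : Q ∉ Set.range pt) :
    ∃ u : Fin k → F, (∀ i, u ⬝ᵥ phiAff k (pt i) = 0) ∧ u ⬝ᵥ phiAff k Q ≠ 0 := by
  by_contra! hall
  obtain ⟨h, f, h0, hj, hfh, hh, hf⟩ := exists_pair_forall_dotProduct_eq_zero
    (fun i => phiAff k (pt i)) (by omega) ⟨topIndex k, topIndex_lt hk⟩
  obtain ⟨c, hc⟩ := exists_eq_smul_of_poleOrder_le (W := W) (h := h) (f := f)
    (pt := fun o : Option ι => o.elim Q pt)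
    (Option.injective_iff.mpr ⟨hinj, hQpt⟩) (Option.forall.mpr ⟨hQ, hpt⟩) h0
    (Option.forall.mpr ⟨hall h hh, hh⟩) (Option.forall.mpr ⟨hall f hf, hf⟩)
    (fun j hne => by
      have := poleOrder_lt (j := j) (fun e => hne (by rw [← hj]; exact congrArg h (Fin.ext e)))
      rw [Fintype.card_option]; omega)
    (fun j _ => by
      have := poleOrder_le j
      rw [Fintype.card_option]; omega)
  exact hfh c hc

/-- `k - 2` affine points can be separated from the point at infinity by a function of pole order
exactly `k`. -/
lemma exists_dotProduct_phiInf_ne_zero (hinj : Function.Injective pt)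
    (hpt : ∀ i, W.Equation (pt i).1 (pt i).2) (hk : 3 ≤ k) (hι : Fintype.card ι + 2 = k) :
    ∃ u : Fin k → F, (∀ i, u ⬝ᵥ phiAff k (pt i) = 0) ∧ u ⬝ᵥ phiInf F k ≠ 0 := by
  by_contra! hall
  simp only [dotProduct_phiInf hk] at hall
  obtain ⟨h, f, h0, hj, hfh, hh, hf⟩ := exists_pair_forall_dotProduct_eq_zero
    (fun i => phiAff k (pt i)) (by omega) ⟨subtopIndex k, subtopIndex_lt hk⟩
  have htop : ∀ u : Fin k → F, (∀ i, u ⬝ᵥ phiAff k (pt i) = 0) → ∀ j, u j ≠ 0 →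
      (j : ℕ) ≠ topIndex k := fun u hu j hne e =>
    hne (by rw [← hall u hu]; exact congrArg u (Fin.ext e))
  obtain ⟨c, hc⟩ := exists_eq_smul_of_poleOrder_le hinj hpt h0 hh hf
    (fun j hne => by
      have := poleOrder_add_two_le hk (htop h hh j hne)
        (fun e => hne (by rw [← hj]; exact congrArg h (Fin.ext e)))
      omega)
    (fun j hne => by
      have := poleOrder_lt (htop f hf j hne)
      omega)
  exact hfh c hc

end Orthogonal

lemma ncard_preimage_of_surjective [Fintype F] {V V' : Type*} [AddCommGroup V] [Module F V]
    [AddCommGroup V'] [Module F V'] [FiniteDimensional F V] [FiniteDimensional F V']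
    {f : V →ₗ[F] V'} (hf : Function.Surjective f) (T : Set V') :
    (f ⁻¹' T).ncard =
      T.ncard * Fintype.card F ^ (Module.finrank F V - Module.finrank F V') := by
  obtain ⟨g, hg⟩ := f.exists_rightInverse_of_surjective (LinearMap.range_eq_top.mpr hf)
  have hfg : ∀ x, f (g x) = x := fun x => LinearMap.congr_fun hg x
  let e : f ⁻¹' T ≃ T × LinearMap.ker f :=
    { toFun := fun v => (⟨f v, v.2⟩, ⟨v - g (f v), by simp [hfg]⟩)
      invFun := fun x => ⟨g x.1 + x.2, by
        have h : f x.2 = 0 := x.2.2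
        simp [hfg, h]⟩
      left_inv := fun v => by simp
      right_inv := fun x => by
        have h : f x.2 = 0 := x.2.2
        ext <;> simp [hfg, h] }
  have hker : Module.finrank F (LinearMap.ker f) =
      Module.finrank F V - Module.finrank F V' := by
    rw [← f.finrank_range_add_finrank_ker, LinearMap.range_eq_top.mpr hf, finrank_top,
      Nat.add_sub_cancel_left]
  rw [← Nat.card_coe_set_eq, Nat.card_congr e, Nat.card_prod, Nat.card_coe_set_eq,
    Module.natCard_eq_pow_finrank (K := F), hker, Nat.card_eq_fintype_card]

section Code

variable {n : ℕ} {P : Fin n → F × F}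

lemma dotProduct_Hmat_mulVec (u : Fin k → F) (v : Fin n → F) :
    u ⬝ᵥ (Hmat k P) *ᵥ v = ∑ i, (u ⬝ᵥ phiAff k (P i)) * v i := by
  rw [dotProduct_mulVec]
  rfl

lemma mulVec_Hmat_surjective (hinj : Function.Injective P)
    (hP : ∀ i, W.Equation (P i).1 (P i).2) (hkn : k < n) :
    Function.Surjective (Hmat k P).mulVecLin := by
  rw [← LinearMap.range_eq_top]
  by_contra hne
  obtain ⟨φ, hφ0, hφ⟩ := Submodule.exists_le_ker_of_lt_top _ (lt_top_iff_ne_top.mpr hne)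
  obtain ⟨u, rfl⟩ := (dotProductEquiv F (Fin k)).surjective φ
  have hu : u = 0 := by
    refine eq_zero_of_forall_dotProduct_phiAff_eq_zero hinj hP (by simpa using hkn) fun i => ?_
    have := hφ (LinearMap.mem_range_self _ (Pi.single i 1))
    simpa only [mulVecLin_apply, mulVec_single_one, LinearMap.mem_ker] using! this
  exact hφ0 (by rw [hu, map_zero])

/-- A word whose syndrome can be separated from any `k - 2` columns has distance at least `k - 1`
from the code. -/
lemma le_dTo_of_forall_exists [DecidableEq F] (hkn : k ≤ n) (hk : 2 ≤ k) {v : Fin n → F}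
    (hv : ∀ S : Finset (Fin n), S.card + 2 = k → ∃ u : Fin k → F,
      (∀ i ∈ S, u ⬝ᵥ phiAff k (P i) = 0) ∧ u ⬝ᵥ (Hmat k P) *ᵥ v ≠ 0) :
    k - 1 ≤ dTo v (resCode k P) := by
  obtain ⟨c, hc, hcd⟩ := Nat.sInf_mem
    (Set.Nonempty.image (hammingDist v) ⟨0, mulVec_zero (Hmat k P)⟩ :
      (hammingDist v '' resCode k P).Nonempty)
  rw [dTo, ← hcd]
  by_contra! hlt
  obtain ⟨S, hS, hScard⟩ := Finset.exists_superset_card_eq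
    (s := Finset.univ.filter fun i => v i ≠ c i) (n := k - 2)
    (by change hammingDist v c ≤ _; omega) (by rw [Fintype.card_fin]; omega)
  obtain ⟨u, huS, hu⟩ := hv S (by omega)
  apply hu
  have hvc : (Hmat k P) *ᵥ v = (Hmat k P) *ᵥ (v - c) := by
    rw [mulVec_sub, show (Hmat k P) *ᵥ c = 0 from hc, sub_zero]
  rw [hvc, dotProduct_Hmat_mulVec]
  refine Finset.sum_eq_zero fun i _ => ?_
  by_cases hi : i ∈ S
  · rw [huS i hi, zero_mul]
  · have : v i = c i := by
      by_contra hne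
      exact hi (hS (by simpa using hne))
    rw [Pi.sub_apply, this, sub_self, mul_zero]

lemma dTo_le_covRad {A : Type*} [Finite A] [DecidableEq A] (v : Fin n → A)
    (C : Set (Fin n → A)) :
    dTo v C ≤ covRad C :=
  le_csSup (Set.finite_range _).bddAbove ⟨v, rfl⟩

end Code

/-- The vector `φ_k` at a rational point, with `none` standing for the point at infinity. -/
def phi (k : ℕ) : Option (F × F) → Fin k → F := fun o => o.elim (phiInf F k) (phiAff k)

lemma injOn_smul_phi (hk : 3 ≤ k) :
    Set.InjOn (fun x : Option (F × F) × F => x.2 • phi k x.1) {x | x.2 ≠ 0} := by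
  have hx0 : ∀ Q : F × F, phiAff k Q ⟨0, by omega⟩ = 1 := fun Q => by simp [phiAff]
  have hx1 : ∀ Q : F × F, phiAff k Q ⟨1, by omega⟩ = Q.1 := fun Q => by
    simp [phiAff, show 1 ≤ k / 2 by omega]
  have hy : ∀ Q : F × F, phiAff k Q ⟨k / 2 + 1, by omega⟩ = Q.2 := fun Q => by simp [phiAff]
  have hinf : phiInf F k ⟨0, by omega⟩ = 0 := by
    rw [phiInf, if_neg]
    split_ifs <;> simp <;> omega
  have htop : phiInf F k ⟨topIndex k, topIndex_lt hk⟩ = 1 := by simp [phiInf, topIndex]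
  rintro ⟨_ | Q, c⟩ hc ⟨_ | R, d⟩ hd h <;> simp only [phi, Option.elim] at h
  · have := congrFun h ⟨topIndex k, topIndex_lt hk⟩
    simp only [Pi.smul_apply, htop, smul_eq_mul, mul_one] at this
    rw [this]
  · have := congrFun h ⟨0, by omega⟩
    simp only [Pi.smul_apply, hinf, hx0, smul_eq_mul, mul_one, mul_zero] at this
    exact absurd this.symm hd
  · have := congrFun h ⟨0, by omega⟩
    simp only [Pi.smul_apply, hinf, hx0, smul_eq_mul, mul_one, mul_zero] at this
    exact absurd this hc
  · have h0 := congrFun h ⟨0, by omega⟩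
    simp only [Pi.smul_apply, hx0, smul_eq_mul, mul_one] at h0
    subst h0
    have hcancel := smul_right_injective _ hc h
    have h1 := congrFun hcancel ⟨1, by omega⟩
    have h2 := congrFun hcancel ⟨k / 2 + 1, by omega⟩
    rw [hx1, hx1] at h1
    rw [hy, hy] at h2
    rw [Prod.ext h1 h2]

/-- The nonzero multiples of the vectors `φ_k(Q)` with `Q` a rational point outside `D`. -/
def syndromes {n : ℕ} (s t : F) (k : ℕ) (P : Fin n → F × F) : Set (Fin k → F) :=
  {w | ∃ c : F, c ≠ 0 ∧ (w = c • phiInf F k ∨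
    ∃ Q : F × F, onCurve s t Q ∧ Q ∉ Set.range P ∧ w = c • phiAff k Q)}

lemma ncard_syndromes [Fintype F] [DecidableEq F] {n : ℕ} {s t : F} {P : Fin n → F × F}
    (hinj : Function.Injective P) (hP : ∀ i, onCurve s t (P i)) (hk : 3 ≤ k) :
    (syndromes s t k P).ncard = (numPoints F s t - n) * (Fintype.card F - 1) := by
  let A : Finset (F × F) := Finset.univ.filter fun Q => Q.2 ^ 2 = Q.1 ^ 3 + s * Q.1 + t
  let B : Finset (F × F) := Finset.univ.image P
  have hBA : B ⊆ A := by
    intro Q hQ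
    obtain ⟨i, -, rfl⟩ := Finset.mem_image.mp hQ
    exact Finset.mem_filter.mpr ⟨Finset.mem_univ _, hP i⟩
  have hB : B.card = n := by
    rw [Finset.card_image_of_injective _ hinj, Finset.card_univ, Fintype.card_fin]
  have himage : syndromes s t k P = (fun x : Option (F × F) × F => x.2 • phi k x.1) ''
      ((Finset.insertNone (A \ B) ×ˢ Finset.univ.erase 0 : Finset (Option (F × F) × F)) :
        Set (Option (F × F) × F)) := by
    ext w
    constructor
    · rintro ⟨c, hc, rfl | ⟨Q, hQ, hQP, rfl⟩⟩
      · exact ⟨(none, c), by simp [hc], rfl⟩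
      · refine ⟨(some Q, c), ?_, rfl⟩
        have hQ' : Q.2 ^ 2 = Q.1 ^ 3 + s * Q.1 + t := hQ
        simpa [hc, A, B, hQ'] using hQP
    · rintro ⟨⟨_ | Q, c⟩, hx, rfl⟩
      · exact ⟨c, by simpa using hx, Or.inl rfl⟩
      · have hx' : (onCurve s t Q ∧ Q ∉ Set.range P) ∧ c ≠ 0 := by
          simpa [A, B, onCurve] using hx
        exact ⟨c, hx'.2, Or.inr ⟨Q, hx'.1.1, hx'.1.2, rfl⟩⟩
  rw [himage, Set.InjOn.ncard_image, Set.ncard_coe_finset, Finset.card_product,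
    Finset.card_insertNone, Finset.card_sdiff_of_subset hBA, hB, Finset.card_erase_of_mem
    (Finset.mem_univ _), Finset.card_univ]
  · have hle : n ≤ A.card := hB ▸ Finset.card_le_card hBA
    rw [numPoints, Nat.sub_add_comm hle]
  · exact (injOn_smul_phi hk).mono fun x hx => by
      have := (Finset.mem_product.mp hx).2
      exact (Finset.mem_erase.mp this).1

end EllipticCode

/-- For `3 ≤ k ≤ n−2`, the set `Δ` of words whose syndrome is a nonzero
multiple of `φ_k(Q)` for some rational point `Q ∈ E(F_q) ∖ D` (including `Q = O`) has exactly
`(|E(F_q)|−n)·(q−1)·q^{n−k}` elements; and if `C_Ω(D,kO)` has covering radius `k−1`, every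
element of `Δ` is a deep hole of `C_Ω(D,kO)`. -/
theorem card_and_deep_holes_of_syndrome_set
    (F : Type) [Field F] [Fintype F] [DecidableEq F]
    (hq : Odd (Fintype.card F))
    (s t : F) (hdisc : 4 * s ^ 3 + 27 * t ^ 2 ≠ 0)
    {n : ℕ} (k : ℕ) (P : Fin n → F × F)
    (hPinj : Function.Injective P)
    (hPcurve : ∀ i, onCurve s t (P i))
    (hk3 : 3 ≤ k) (hkn : k ≤ n - 2)
    (Δ : Set (Fin n → F))
    (hΔ : Δ = {v | ∃ c : F, c ≠ 0 ∧
      (Matrix.mulVec (Hmat k P) v = c • phiInf F k ∨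
        ∃ Q : F × F, onCurve s t Q ∧ Q ∉ Set.range P ∧
          Matrix.mulVec (Hmat k P) v = c • phiAff k Q)}) :
    Δ.ncard = (numPoints F s t - n) * (Fintype.card F - 1) * Fintype.card F ^ (n - k) ∧
      (covRad (resCode k P) = k - 1 →
        ∀ v ∈ Δ, dTo v (resCode k P) = covRad (resCode k P)) := by
  let W : WeierstrassCurve.Affine F := ⟨0, 0, 0, s, t⟩
  have hW : ∀ Q : F × F, onCurve s t Q → W.Equation Q.1 Q.2 := fun Q hQ => by
    rw [WeierstrassCurve.Affine.equation_iff]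
    simpa [W, onCurve] using hQ
  have hP : ∀ i, W.Equation (P i).1 (P i).2 := fun i => hW _ (hPcurve i)
  have hpre : Δ = (Hmat k P).mulVecLin ⁻¹' EllipticCode.syndromes s t k P := hΔ
  refine ⟨?_, fun hρ v hv => (EllipticCode.dTo_le_covRad _ _).antisymm ?_⟩
  · rw [hpre, EllipticCode.ncard_preimage_of_surjective
      (EllipticCode.mulVec_Hmat_surjective hPinj hP (by omega)),
      EllipticCode.ncard_syndromes hPinj hPcurve hk3]
    simp
  · rw [hρ]
    refine EllipticCode.le_dTo_of_forall_exists (by omega) (by omega) fun S hS => ?_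
    have hSinj : Function.Injective fun i : S => P i := hPinj.comp Subtype.val_injective
    rw [hΔ] at hv
    obtain ⟨c, hc, hv | ⟨Q, hQ, hQP, hv⟩⟩ := hv
    · obtain ⟨u, hu, hu0⟩ := EllipticCode.exists_dotProduct_phiInf_ne_zero hSinj
        (fun i => hP i) hk3 (by simpa using hS)
      exact ⟨u, fun i hi => hu ⟨i, hi⟩, by
        rw [hv, dotProduct_smul]
        exact smul_ne_zero hc hu0⟩
    · obtain ⟨u, hu, hu0⟩ := EllipticCode.exists_dotProduct_phiAff_ne_zero hSinj
        (fun i => hP i) hk3 (by simpa using hS) (hW Q hQ)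
        (fun ⟨i, hi⟩ => hQP ⟨i, hi⟩)
      exact ⟨u, fun i hi => hu ⟨i, hi⟩, by
        rw [hv, dotProduct_smul]
        exact smul_ne_zero hc hu0⟩
end

section
/- Let 2 ≤ k ≤ n−2, and let C be either the residue elliptic code C_Ω(D,kO) or the functional elliptic code C_L(D,kO). Then the covering radius of C equals either n−dim(C)−1 or n−dim(C). -/
open Matrix BigOperators

section LinearCode

variable {F : Type*} [Field F] [DecidableEq F] {n : ℕ}

/-- The redundancy bound on the distance from a word to a linear code. -/
lemma exists_mem_hammingDist_le_sub_finrank (C : Submodule F (Fin n → F)) (v : Fin n → F) :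
    ∃ c ∈ C, hammingDist v c ≤ n - Module.finrank F C := by
  classical
  let e : Fin n → (Fin n → F) ⧸ C := fun i => C.mkQ (Pi.single i 1)
  obtain ⟨κ, a, ha, hspan, hli⟩ := exists_linearIndependent' F e
  have : Finite κ := Finite.of_injective a ha
  have := Fintype.ofFinite κ
  have htop : Submodule.span F (Set.range e) = ⊤ := by
    have : Set.range e = C.mkQ '' Set.range (Pi.basisFun F (Fin n)) := by
      rw [← Set.range_comp]
      congr 1
      ext i
      simp [e]
    rw [this, Submodule.span_image, (Pi.basisFun F (Fin n)).span_eq, Submodule.map_top,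
      Submodule.range_mkQ]
  have hcard : Fintype.card κ ≤ n - Module.finrank F C := by
    have h1 := hli.fintype_card_le_finrank
    have h2 := C.finrank_quotient_add_finrank
    rw [Module.finrank_fin_fun] at h2
    omega
  have hv : C.mkQ v ∈ Submodule.span F (Set.range (e ∘ a)) := by
    rw [hspan, htop]
    trivial
  obtain ⟨b, hb⟩ := (Submodule.mem_span_range_iff_exists_fun F).1 hv
  let w : Fin n → F := ∑ j, b j • Pi.single (a j) (1 : F)
  have hw : C.mkQ w = C.mkQ v := by
    rw [← hb, map_sum]
    simp [e]
  refine ⟨v - w, ?_, ?_⟩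
  · rw [← Submodule.ker_mkQ C, LinearMap.mem_ker, map_sub, hw, sub_self]
  · refine le_trans ?_ hcard
    unfold hammingDist
    calc _ ≤ (Finset.univ.image a).card := by
          refine Finset.card_le_card fun i hi => ?_
          by_contra hne
          simp only [Finset.mem_filter, Finset.mem_univ, true_and, ne_eq, Pi.sub_apply] at hi
          apply hi
          have : w i = 0 := by
            simp only [w, Finset.sum_apply, Pi.smul_apply]
            refine Finset.sum_eq_zero fun j _ => ?_
            rw [Pi.single_eq_of_ne, smul_zero]
            rintro rfl
            exact hne (Finset.mem_image_of_mem a (Finset.mem_univ j))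
          rw [this, sub_zero]
      _ ≤ _ := Finset.card_image_le

/-- A linear code having a word at distance at least its redundancy minus one has covering radius
equal to its redundancy or one less. -/
lemma covRad_eq_of_forall_le_hammingDist (C : Submodule F (Fin n → F)) (v : Fin n → F)
    (hv : ∀ c ∈ C, n - Module.finrank F C - 1 ≤ hammingDist v c) :
    covRad (C : Set (Fin n → F)) = n - Module.finrank F C - 1 ∨
      covRad (C : Set (Fin n → F)) = n - Module.finrank F C := by
  have hub : ∀ x ∈ Set.range (fun v : Fin n → F => dTo v (C : Set (Fin n → F))),
      x ≤ n - Module.finrank F C := by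
    rintro _ ⟨u, rfl⟩
    obtain ⟨c, hc, hcu⟩ := exists_mem_hammingDist_le_sub_finrank C u
    exact (Nat.sInf_le (Set.mem_image_of_mem _ hc)).trans hcu
  have h1 : covRad (C : Set (Fin n → F)) ≤ n - Module.finrank F C :=
    csSup_le (Set.range_nonempty _) hub
  have h2 : n - Module.finrank F C - 1 ≤ covRad (C : Set (Fin n → F)) := by
    refine le_trans ?_ (le_csSup (a := dTo v (C : Set (Fin n → F))) ⟨_, hub⟩ ⟨v, rfl⟩)
    refine le_csInf (Set.Nonempty.image _ ⟨0, C.zero_mem⟩) ?_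
    rintro _ ⟨c, hc, rfl⟩
    exact hv c hc
  omega

end LinearCode

section CoordinateRing

open Polynomial WeierstrassCurve.Affine

variable {F : Type*} [Field F]

/-- The affine curve `y² = x³ + s x + t`. -/
abbrev shortCurve (s t : F) : WeierstrassCurve.Affine F := ⟨0, 0, 0, s, t⟩

lemma onCurve.eval_polynomial {s t : F} {Q : F × F} (hQ : onCurve s t Q) :
    (shortCurve s t).polynomial.evalEval Q.1 Q.2 = 0 := by
  rw [evalEval_polynomial]
  simp only [onCurve] at hQ
  linear_combination hQ

/-- Evaluation of regular functions at an affine point of the curve. -/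
noncomputable def evalPoint {s t : F} {Q : F × F} (hQ : onCurve s t Q) :
    (shortCurve s t).CoordinateRing →ₐ[F] F :=
  { AdjoinRoot.evalEval hQ.eval_polynomial with
    commutes' := fun r => by
      change AdjoinRoot.evalEval hQ.eval_polynomial (AdjoinRoot.mk _ (C (C r))) = r
      rw [AdjoinRoot.evalEval_mk, evalEval_C, eval_C] }

lemma evalPoint_mk {s t : F} {Q : F × F} (hQ : onCurve s t Q) (g : F[X][X]) :
    evalPoint hQ (CoordinateRing.mk _ g) = g.evalEval Q.1 Q.2 :=
  AdjoinRoot.evalEval_mk hQ.eval_polynomial g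

lemma evalPoint_smul_one_add {s t : F} {Q : F × F} (hQ : onCurve s t Q) (p q : F[X]) :
    evalPoint hQ (p • 1 + q • CoordinateRing.mk (shortCurve s t) X) =
      p.eval Q.1 + q.eval Q.1 * Q.2 := by
  rw [CoordinateRing.smul, CoordinateRing.smul, mul_one, ← map_mul, ← map_add, evalPoint_mk]
  simp [evalEval_C]

lemma exists_evalPoint_ne_zero {s t : F} {Q Q' : F × F} (hQ : onCurve s t Q)
    (hQ' : onCurve s t Q') (hne : Q ≠ Q') :
    ∃ f, evalPoint hQ f ≠ 0 ∧ evalPoint hQ' f = 0 := by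
  by_cases h : Q.1 = Q'.1
  · have h2 : Q.2 ≠ Q'.2 := fun h2 => hne (Prod.ext h h2)
    refine ⟨CoordinateRing.mk _ (X - C (C Q'.2)), ?_, ?_⟩ <;> rw [evalPoint_mk]
    · simpa using sub_ne_zero.2 h2
    · simp
  · refine ⟨CoordinateRing.mk _ (C (X - C Q'.1)), ?_, ?_⟩ <;> rw [evalPoint_mk]
    · simpa [evalEval_C] using sub_ne_zero.2 h
    · simp [evalEval_C]

variable {s t : F} {ι : Type*} {P : ι → F × F}

/-- Simultaneous evaluation at a family of points. -/
noncomputable def evalPoints (hP : ∀ i, onCurve s t (P i)) :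
    (shortCurve s t).CoordinateRing →ₐ[F] (ι → F) :=
  AlgHom.pi fun i => evalPoint (hP i)

lemma evalPoints_apply (hP : ∀ i, onCurve s t (P i)) (f) (i : ι) :
    evalPoints hP f i = evalPoint (hP i) f := rfl

variable [Fintype ι]

lemma evalPoints_surjective (hP : ∀ i, onCurve s t (P i)) (hinj : Function.Injective P) :
    Function.Surjective (evalPoints hP) := by
  classical
  have h : ∀ i j, i ≠ j → ∃ f, evalPoint (hP i) f ≠ 0 ∧ evalPoint (hP j) f = 0 :=
    fun i j hij => exists_evalPoint_ne_zero (hP i) (hP j) (hinj.ne hij)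
  choose! g hg using h
  let G : ι → (shortCurve s t).CoordinateRing := fun i => ∏ j ∈ Finset.univ.erase i, g i j
  have hG : ∀ i, evalPoint (hP i) (G i) ≠ 0 := fun i => by
    rw [map_prod, Finset.prod_ne_zero_iff]
    exact fun j hj => (hg i j (Finset.ne_of_mem_erase hj).symm).1
  have hG0 : ∀ i j, i ≠ j → evalPoint (hP j) (G i) = 0 := fun i j hij => by
    rw [map_prod]
    exact Finset.prod_eq_zero (Finset.mem_erase.2 ⟨hij.symm, Finset.mem_univ _⟩) (hg i j hij).2
  intro y
  refine ⟨∑ i, (y i / evalPoint (hP i) (G i)) • G i, funext fun j => ?_⟩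
  rw [evalPoints_apply, map_sum, Finset.sum_eq_single j]
  · rw [map_smul, smul_eq_mul, div_mul_cancel₀ _ (hG j)]
  · intro i _ hij
    rw [map_smul, hG0 i j hij, smul_zero]
  · simp

lemma norm_coordinateRing_ne_zero {f : (shortCurve s t).CoordinateRing} (hf : f ≠ 0) :
    Algebra.norm F[X] f ≠ 0 :=
  Algebra.norm_ne_zero_iff_of_basis (CoordinateRing.basis _) |>.2 hf

/-- The evaluation map induced on the quotient by a function vanishing at the points. -/
noncomputable def evalPointsQuotient (hP : ∀ i, onCurve s t (P i))
    {f : (shortCurve s t).CoordinateRing} (h0 : evalPoints hP f = 0) :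
    ((shortCurve s t).CoordinateRing ⧸ Ideal.span {f}) →ₐ[F] (ι → F) :=
  Ideal.Quotient.liftₐ _ (evalPoints hP) fun a ha => by
    obtain ⟨b, rfl⟩ := Ideal.mem_span_singleton.1 ha
    rw [map_mul, h0, zero_mul]

lemma evalPointsQuotient_surjective (hP : ∀ i, onCurve s t (P i)) (hinj : Function.Injective P)
    {f : (shortCurve s t).CoordinateRing} (h0 : evalPoints hP f = 0) :
    Function.Surjective (evalPointsQuotient hP h0) := fun y => by
  obtain ⟨g, hg⟩ := evalPoints_surjective hP hinj y
  exact ⟨Ideal.Quotient.mk _ g, hg⟩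

lemma finite_quotient_span_singleton {f : (shortCurve s t).CoordinateRing} (hf : f ≠ 0) :
    Module.Finite F ((shortCurve s t).CoordinateRing ⧸ Ideal.span {f}) := by
  have hI : Ideal.span {f} ≠ ⊥ := Ideal.span_singleton_eq_bot.not.2 hf
  classical
  exact Module.Finite.equiv
    (Ideal.quotientEquivDirectSum F (CoordinateRing.basis (shortCurve s t)) hI).symm

/-- A nonzero function has at most as many zeros as its pole order. -/
lemma card_le_natDegree_norm (hP : ∀ i, onCurve s t (P i)) (hinj : Function.Injective P)
    {f : (shortCurve s t).CoordinateRing} (hf : f ≠ 0) (h0 : evalPoints hP f = 0) :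
    Fintype.card ι ≤ (Algebra.norm F[X] f).natDegree := by
  have hfr := finrank_quotient_span_eq_natDegree_norm (F := F)
    (CoordinateRing.basis (shortCurve s t)) hf
  have : Module.Finite F ((shortCurve s t).CoordinateRing ⧸ Ideal.span {f}) :=
    finite_quotient_span_singleton hf
  rw [← hfr, ← Module.finrank_fintype_fun_eq_card F]
  exact (evalPointsQuotient hP h0).toLinearMap.finrank_le_finrank_of_surjective
    (evalPointsQuotient_surjective hP hinj h0)

/-- A function with as many zeros as its pole order divides every function with these zeros. -/
lemma dvd_of_natDegree_norm_eq (hP : ∀ i, onCurve s t (P i)) (hinj : Function.Injective P)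
    {f g : (shortCurve s t).CoordinateRing} (hf : f ≠ 0) (h0 : evalPoints hP f = 0)
    (hd : (Algebra.norm F[X] f).natDegree = Fintype.card ι) (hg : evalPoints hP g = 0) :
    f ∣ g := by
  have hfr := finrank_quotient_span_eq_natDegree_norm (F := F)
    (CoordinateRing.basis (shortCurve s t)) hf
  have : Module.Finite F ((shortCurve s t).CoordinateRing ⧸ Ideal.span {f}) :=
    finite_quotient_span_singleton hf
  have hi : Function.Injective (evalPointsQuotient hP h0).toLinearMap :=
    (LinearMap.injective_iff_surjective_of_finrank_eq_finrank
      (by rw [hfr, hd, Module.finrank_fintype_fun_eq_card])).2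
      (evalPointsQuotient_surjective hP hinj h0)
  have : Ideal.Quotient.mk (Ideal.span {f}) g = 0 := hi (by
    rw [map_zero]
    exact hg)
  exact Ideal.mem_span_singleton.1 (Ideal.Quotient.eq_zero_iff_mem.1 this)

variable (s t) in
/-- The Riemann–Roch space of functions with pole order at most `m` at infinity. -/
noncomputable def riemannRoch (m : ℕ) : Submodule F (shortCurve s t).CoordinateRing where
  carrier := {f | ∃ p q : F[X], 2 * p.natDegree ≤ m ∧ (q ≠ 0 → 2 * q.natDegree + 3 ≤ m) ∧
    f = p • 1 + q • CoordinateRing.mk _ X}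
  add_mem' := by
    rintro _ _ ⟨p, q, hp, hq, rfl⟩ ⟨p', q', hp', hq', rfl⟩
    refine ⟨p + p', q + q', ?_, fun h => ?_, by simp only [add_smul]; abel⟩
    · have := natDegree_add_le p p'
      omega
    · by_cases h1 : q = 0
      · subst h1
        rw [zero_add] at h ⊢
        exact hq' h
      · by_cases h2 : q' = 0
        · subst h2
          rw [add_zero] at h ⊢
          exact hq h
        · have := natDegree_add_le q q'
          have := hq h1
          have := hq' h2
          omega
  zero_mem' := ⟨0, 0, by simp⟩
  smul_mem' := by
    rintro c _ ⟨p, q, hp, hq, rfl⟩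
    refine ⟨c • p, c • q, ?_, fun h => ?_, by rw [smul_add, smul_assoc, smul_assoc]⟩
    · have := natDegree_smul_le c p
      omega
    · have := natDegree_smul_le c q
      have := hq (right_ne_zero_of_smul h)
      omega

lemma X_pow_smul_one_mem_riemannRoch {i m : ℕ} (h : 2 * i ≤ m) :
    (X ^ i : F[X]) • (1 : (shortCurve s t).CoordinateRing) ∈ riemannRoch s t m :=
  ⟨X ^ i, 0, by simpa using h, by simp, by simp⟩

lemma X_pow_smul_Y_mem_riemannRoch {i m : ℕ} (h : 2 * i + 3 ≤ m) :
    (X ^ i : F[X]) • CoordinateRing.mk (shortCurve s t) X ∈ riemannRoch s t m :=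
  ⟨0, X ^ i, by simp, by simpa using h, by simp⟩

lemma natDegree_norm_le_of_mem_riemannRoch {m : ℕ} {f : (shortCurve s t).CoordinateRing}
    (hf : f ∈ riemannRoch s t m) : (Algebra.norm F[X] f).natDegree ≤ m := by
  obtain ⟨p, q, hp, hq, rfl⟩ := hf
  apply natDegree_le_of_degree_le
  rw [CoordinateRing.degree_norm_smul_basis]
  refine max_le ?_ ?_
  · by_cases h : p = 0
    · simp [h]
    · rw [degree_eq_natDegree h, nsmul_eq_mul]
      exact_mod_cast hp
  · by_cases h : q = 0
    · simp [h]
    · rw [degree_eq_natDegree h, nsmul_eq_mul]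
      exact_mod_cast hq h

lemma le_natDegree_norm_smul_basis (p q : F[X]) (hq : q ≠ 0) :
    2 * q.natDegree + 3 ≤ (Algebra.norm F[X]
      (p • 1 + q • CoordinateRing.mk (shortCurve s t) X)).natDegree := by
  apply le_natDegree_of_coe_le_degree
  rw [CoordinateRing.degree_norm_smul_basis, degree_eq_natDegree hq]
  exact le_max_of_le_right (by norm_cast)

lemma exists_algebraMap_eq_of_natDegree_norm_le_one {h : (shortCurve s t).CoordinateRing}
    (hd : (Algebra.norm F[X] h).natDegree ≤ 1) : ∃ c : F, h = algebraMap F _ c := by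
  obtain ⟨p, q, rfl⟩ := CoordinateRing.exists_smul_basis_eq h
  have hq : q = 0 := by
    by_contra hq
    have := le_natDegree_norm_smul_basis (s := s) (t := t) p q hq
    omega
  subst hq
  have hp : p.natDegree = 0 := by
    by_contra hp
    have hp0 : p ≠ 0 := by
      rintro rfl
      simp at hp
    have h2 : 2 * p.natDegree ≤ (Algebra.norm F[X]
      (p • 1 + (0 : F[X]) • CoordinateRing.mk (shortCurve s t) X)).natDegree := by
      apply le_natDegree_of_coe_le_degree
      rw [CoordinateRing.degree_norm_smul_basis, degree_eq_natDegree hp0]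
      exact le_max_of_le_left (by norm_cast)
    omega
  rw [eq_C_of_natDegree_eq_zero hp]
  refine ⟨p.coeff 0, ?_⟩
  rw [zero_smul, add_zero, CoordinateRing.smul, mul_one]
  rfl

/-- Among the functions with zeros at `m` given points and pole order at most `m + 1`, all are
multiples of any nonzero one with pole order at most `m`. -/
lemma exists_eq_smul_of_evalPoints_eq_zero (hP : ∀ i, onCurve s t (P i))
    (hinj : Function.Injective P) {f g : (shortCurve s t).CoordinateRing} (hf : f ≠ 0)
    (hf0 : evalPoints hP f = 0) (hg0 : evalPoints hP g = 0)
    (hfm : f ∈ riemannRoch s t (Fintype.card ι))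
    (hgm : g ∈ riemannRoch s t (Fintype.card ι + 1)) : ∃ c : F, g = c • f := by
  have hd : (Algebra.norm F[X] f).natDegree = Fintype.card ι :=
    (natDegree_norm_le_of_mem_riemannRoch hfm).antisymm (card_le_natDegree_norm hP hinj hf hf0)
  obtain ⟨h, rfl⟩ := dvd_of_natDegree_norm_eq hP hinj hf hf0 hd hg0
  by_cases h0 : h = 0
  · exact ⟨0, by simp [h0]⟩
  have hle := natDegree_norm_le_of_mem_riemannRoch hgm
  rw [map_mul, natDegree_mul (norm_coordinateRing_ne_zero hf) (norm_coordinateRing_ne_zero h0),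
    hd] at hle
  obtain ⟨c, rfl⟩ := exists_algebraMap_eq_of_natDegree_norm_le_one (h := h) (by omega)
  exact ⟨c, by rw [Algebra.smul_def, mul_comm]⟩

end CoordinateRing

section EllipticCode

open Polynomial WeierstrassCurve.Affine

variable {F : Type*} [Field F] {s t : F}

variable (s t) in
/-- The monomial function on the curve with the given index. -/
noncomputable def monomialFun (k j : ℕ) : (shortCurve s t).CoordinateRing :=
  if j ≤ k / 2 then (X ^ j : F[X]) • 1
  else (X ^ (j - k / 2 - 1) : F[X]) • CoordinateRing.mk (shortCurve s t) X

variable (s t) in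
/-- The function on the curve with given coefficients in the monomial basis. -/
noncomputable def coeffsToFun (k : ℕ) : (Fin k → F) →ₗ[F] (shortCurve s t).CoordinateRing :=
  Fintype.linearCombination F fun j : Fin k => monomialFun s t k j

lemma coeffsToFun_apply (k : ℕ) (u : Fin k → F) :
    coeffsToFun s t k u = ∑ j, u j • monomialFun s t k j := rfl

lemma evalPoint_monomialFun {Q : F × F} (hQ : onCurve s t Q) (k : ℕ) (j : Fin k) :
    evalPoint hQ (monomialFun s t k j) = phiAff k Q j := by
  have h1 := evalPoint_smul_one_add hQ (X ^ (j : ℕ)) 0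
  have h2 := evalPoint_smul_one_add hQ 0 (X ^ ((j : ℕ) - k / 2 - 1))
  rw [zero_smul, add_zero] at h1
  rw [zero_smul, zero_add] at h2
  unfold monomialFun phiAff
  split_ifs
  · rw [h1]
    simp
  · rw [h2]
    simp [mul_comm]

lemma evalPoint_coeffsToFun {n : ℕ} {P : Fin n → F × F} (hP : ∀ i, onCurve s t (P i)) (k : ℕ)
    (u : Fin k → F) (i : Fin n) :
    evalPoint (hP i) (coeffsToFun s t k u) = Matrix.vecMul u (Hmat k P) i := by
  simp [coeffsToFun_apply, evalPoint_monomialFun, Matrix.vecMul, dotProduct, Hmat]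

lemma coeffsToFun_eq_smul_basis (k : ℕ) (u : Fin k → F) : coeffsToFun s t k u =
    (∑ j : Fin k, if (j : ℕ) ≤ k / 2 then monomial (j : ℕ) (u j) else 0) • 1 +
    (∑ j : Fin k, if (j : ℕ) ≤ k / 2 then 0 else monomial ((j : ℕ) - k / 2 - 1) (u j)) •
      CoordinateRing.mk (shortCurve s t) X := by
  rw [coeffsToFun_apply, Finset.sum_smul, Finset.sum_smul, ← Finset.sum_add_distrib]
  refine Finset.sum_congr rfl fun j _ => ?_
  unfold monomialFun
  split_ifs <;> simp [← smul_X_eq_monomial, smul_assoc]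

lemma coeffsToFun_injective (k : ℕ) : Function.Injective (coeffsToFun s t k) := by
  rw [injective_iff_map_eq_zero]
  intro u hu
  rw [coeffsToFun_eq_smul_basis] at hu
  obtain ⟨hp, hq⟩ := CoordinateRing.smul_basis_eq_zero hu
  funext i
  by_cases hi : (i : ℕ) ≤ k / 2
  · have := congrArg (fun p => coeff p (i : ℕ)) hp
    simp only [finsetSum_coeff, coeff_zero] at this
    rw [Finset.sum_eq_single i] at this
    · simpa [hi] using this
    · intro j _ hj
      split_ifs
      · rw [coeff_monomial_of_ne]
        exact fun h => hj (Fin.ext h.symm)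
      · simp
    · simp
  · have := congrArg (fun p => coeff p ((i : ℕ) - k / 2 - 1)) hq
    simp only [finsetSum_coeff, coeff_zero] at this
    rw [Finset.sum_eq_single i] at this
    · simpa [hi] using this
    · intro j _ hj
      split_ifs
      · simp
      · rw [coeff_monomial_of_ne]
        exact fun h => hj (Fin.ext (by omega))
    · simp

/-- The pole order of the monomial with the given index. -/
def monomialOrder (k j : ℕ) : ℕ := if j ≤ k / 2 then 2 * j else 2 * (j - k / 2 - 1) + 3

lemma monomialFun_mem_riemannRoch {k j m : ℕ} (h : monomialOrder k j ≤ m) :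
    monomialFun s t k j ∈ riemannRoch s t m := by
  unfold monomialOrder at h
  unfold monomialFun
  split_ifs at h ⊢
  · exact X_pow_smul_one_mem_riemannRoch h
  · exact X_pow_smul_Y_mem_riemannRoch h

lemma coeffsToFun_mem_riemannRoch {k m : ℕ} {u : Fin k → F}
    (h : ∀ j : Fin k, u j ≠ 0 → monomialOrder k j ≤ m) :
    coeffsToFun s t k u ∈ riemannRoch s t m := by
  rw [coeffsToFun_apply]
  refine Submodule.sum_mem _ fun j _ => ?_
  by_cases hj : u j = 0
  · simp [hj]
  · exact Submodule.smul_mem _ _ (monomialFun_mem_riemannRoch (h j hj))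

lemma coeffsToFun_mem_riemannRoch_self {k : ℕ} (u : Fin k → F) :
    coeffsToFun s t k u ∈ riemannRoch s t k := by
  refine coeffsToFun_mem_riemannRoch fun j _ => ?_
  unfold monomialOrder
  split_ifs <;> omega

variable {n : ℕ} {P : Fin n → F × F} {k : ℕ}

lemma vecMul_Hmat_injective (hP : ∀ i, onCurve s t (P i)) (hinj : Function.Injective P)
    (hkn : k < n) : Function.Injective fun u : Fin k → F => u ᵥ* Hmat k P := by
  refine (injective_iff_map_eq_zero (Hmat k P).vecMulLinear).2 fun u hu => ?_
  by_contra hne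
  have h := card_le_natDegree_norm hP hinj
    ((map_ne_zero_iff _ (coeffsToFun_injective (s := s) (t := t) k)).2 hne)
    (funext fun i => (evalPoint_coeffsToFun hP k u i).trans (congrFun hu i))
  have := natDegree_norm_le_of_mem_riemannRoch
    (coeffsToFun_mem_riemannRoch_self (s := s) (t := t) u)
  rw [Fintype.card_fin] at h
  omega

lemma rank_Hmat (hP : ∀ i, onCurve s t (P i)) (hinj : Function.Injective P)
    (hkn : k < n) : (Hmat k P).rank = k := by
  have := (Matrix.vecMul_injective_iff.1 (vecMul_Hmat_injective hP hinj hkn)).rank_matrix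
  rwa [Fintype.card_fin] at this

lemma mulVec_Hmat_surjective (hP : ∀ i, onCurve s t (P i)) (hinj : Function.Injective P)
    (hkn : k < n) : Function.Surjective (Hmat k P).mulVecLin := by
  rw [← LinearMap.range_eq_top]
  apply Submodule.eq_top_of_finrank_eq
  rw [Module.finrank_fin_fun]
  exact rank_Hmat hP hinj hkn

lemma finrank_ker_mulVecLin_Hmat (hP : ∀ i, onCurve s t (P i)) (hinj : Function.Injective P)
    (hkn : k < n) : Module.finrank F (LinearMap.ker (Hmat k P).mulVecLin) = n - k := by
  have h1 := LinearMap.finrank_range_add_finrank_ker (Hmat k P).mulVecLin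
  have h2 : Module.finrank F (LinearMap.range (Hmat k P).mulVecLin) = k :=
    rank_Hmat hP hinj hkn
  rw [Module.finrank_fin_fun, h2] at h1
  omega

lemma finrank_range_vecMulLinear_Hmat (hP : ∀ i, onCurve s t (P i)) (hinj : Function.Injective P)
    (hkn : k < n) :
    Module.finrank F (LinearMap.range (Hmat k P).vecMulLinear) = k := by
  rw [LinearMap.finrank_range_of_inj (vecMul_Hmat_injective hP hinj hkn),
    Module.finrank_fin_fun]

lemma card_le_hammingDist_add [DecidableEq F] (hP : ∀ i, onCurve s t (P i))
    (hinj : Function.Injective P) {m : ℕ} {f g : (shortCurve s t).CoordinateRing} (hne : f ≠ g)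
    (hf : f ∈ riemannRoch s t m) (hg : g ∈ riemannRoch s t m) :
    n ≤ hammingDist (evalPoints hP f) (evalPoints hP g) + m := by
  let Z := Finset.univ.filter fun i => evalPoints hP f i = evalPoints hP g i
  have h := card_le_natDegree_norm (P := fun i : Z => P i) (fun i => hP i)
    (hinj.comp Subtype.val_injective) (sub_ne_zero.2 hne) (funext fun i => by
      rw [evalPoints_apply, map_sub]
      exact sub_eq_zero.2 (Finset.mem_filter.1 i.2).2)
  have h2 := natDegree_norm_le_of_mem_riemannRoch (Submodule.sub_mem _ hf hg)
  rw [Fintype.card_coe] at h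
  have h3 := Finset.card_filter_add_card_filter_not (s := (Finset.univ : Finset (Fin n)))
    (fun i => evalPoints hP f i = evalPoints hP g i)
  rw [Finset.card_univ, Fintype.card_fin] at h3
  change Z.card + hammingDist (evalPoints hP f) (evalPoints hP g) = n at h3
  omega

/-- A word at distance at least `n - k - 1` from the functional code. -/
lemma exists_forall_le_hammingDist_vecMul [DecidableEq F] (hP : ∀ i, onCurve s t (P i))
    (hinj : Function.Injective P) (hk : 2 ≤ k) :
    ∃ v : Fin n → F, ∀ u : Fin k → F, n - k - 1 ≤ hammingDist v (u ᵥ* Hmat k P) := by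
  obtain ⟨g, hg, hgk⟩ : ∃ g ∈ riemannRoch s t (k + 1), k < (Algebra.norm F[X] g).natDegree := by
    rcases Nat.even_or_odd' k with ⟨r, rfl | rfl⟩
    · refine ⟨_, X_pow_smul_Y_mem_riemannRoch (i := r - 1) (by omega), ?_⟩
      have := le_natDegree_norm_smul_basis (s := s) (t := t) 0 (X ^ (r - 1)) (by simp)
      rw [zero_smul, zero_add, natDegree_X_pow] at this
      omega
    · refine ⟨_, X_pow_smul_one_mem_riemannRoch (i := r + 1) (by omega), ?_⟩
      rw [Nat.lt_iff_add_one_le]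
      apply le_natDegree_of_coe_le_degree
      have := CoordinateRing.degree_norm_smul_basis (W' := shortCurve s t) (X ^ (r + 1)) 0
      rw [zero_smul, add_zero] at this
      rw [this, degree_X_pow]
      refine le_max_of_le_left ?_
      norm_cast
  refine ⟨evalPoints hP g, fun u => ?_⟩
  have hu : u ᵥ* Hmat k P = evalPoints hP (coeffsToFun s t k u) :=
    funext fun i => (evalPoint_coeffsToFun hP k u i).symm
  have hum := coeffsToFun_mem_riemannRoch_self (s := s) (t := t) u
  have hne : g ≠ coeffsToFun s t k u := by
    rintro rfl
    have := natDegree_norm_le_of_mem_riemannRoch hum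
    omega
  obtain ⟨p, q, hp, hq, hpq⟩ := hum
  have := card_le_hammingDist_add hP hinj hne hg
    ⟨p, q, by omega, fun h => (hq h).trans (by omega), hpq⟩
  rw [hu]
  omega

/-- The functions of pole order less than `k` take arbitrary values at `k - 2` points. -/
lemma exists_eq_zero_and_vecMul_eq (hP : ∀ i, onCurve s t (P i)) (hinj : Function.Injective P)
    (hk : 3 ≤ k) {S : Finset (Fin n)} (hS : S.card = k - 2) {top : Fin k}
    (htop : (top : ℕ) = if k % 2 = 0 then k / 2 else k - 1) (y : S → F) :
    ∃ u : Fin k → F, u top = 0 ∧ ∀ i : S, (u ᵥ* Hmat k P) i = y i := by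
  let U := LinearMap.ker (LinearMap.proj top : (Fin k → F) →ₗ[F] F)
  let ev : U →ₗ[F] (S → F) :=
    (LinearMap.funLeft F F (Subtype.val : S → Fin n)).comp
      ((Hmat k P).vecMulLinear.comp U.subtype)
  have hPS : ∀ i : S, onCurve s t (P i) := fun i => hP i
  have hev0 : ∀ u : U, ev u = 0 → evalPoints hPS (coeffsToFun s t k u) = 0 := fun u hu =>
    funext fun i => (evalPoint_coeffsToFun hP k u i).trans (congrFun hu i)
  have hcard : Fintype.card S = k - 2 := by rw [Fintype.card_coe, hS]
  have hU : k ≤ Module.finrank F U + 1 := by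
    have h1 := LinearMap.finrank_range_add_finrank_ker (LinearMap.proj top : (Fin k → F) →ₗ[F] F)
    have h2 := Submodule.finrank_le
      (LinearMap.range (LinearMap.proj top : (Fin k → F) →ₗ[F] F))
    rw [Module.finrank_self] at h2
    rw [Module.finrank_fin_fun] at h1
    change _ + Module.finrank F U = k at h1
    omega
  let nxt : Fin k := ⟨if k % 2 = 0 then k - 1 else k / 2, by split_ifs <;> omega⟩
  have hmem1 : ∀ u : U, coeffsToFun s t k u ∈ riemannRoch s t (Fintype.card S + 1) := fun u => by
    refine coeffsToFun_mem_riemannRoch fun j hj => ?_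
    have hjt : (j : ℕ) ≠ top := fun h => hj (by rw [Fin.ext h]; exact u.2)
    rw [hcard]
    unfold monomialOrder
    split_ifs at htop ⊢ <;> omega
  have hker : Module.finrank F (LinearMap.ker ev) ≤ 1 := by
    by_cases hnxt : ∃ u : U, ev u = 0 ∧ (u : Fin k → F) nxt = 0 ∧ u ≠ 0
    · obtain ⟨u, hu, hun, hu0⟩ := hnxt
      have hmem : coeffsToFun s t k u ∈ riemannRoch s t (Fintype.card S) := by
        refine coeffsToFun_mem_riemannRoch fun j hj => ?_
        have hjt : (j : ℕ) ≠ top := fun h => hj (by rw [Fin.ext h]; exact u.2)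
        have hjn : (j : ℕ) ≠ nxt := fun h => hj (by rw [Fin.ext h]; exact hun)
        simp only [nxt] at hjn
        rw [hcard]
        unfold monomialOrder
        split_ifs at htop hjn ⊢ <;> omega
      refine finrank_le_one (⟨u, hu⟩ : LinearMap.ker ev) fun w => ?_
      obtain ⟨c, hc⟩ := exists_eq_smul_of_evalPoints_eq_zero hPS
        (hinj.comp Subtype.val_injective)
        ((map_ne_zero_iff _ (coeffsToFun_injective (s := s) (t := t) k)).2
          (fun h => hu0 (Subtype.ext h)))
        (hev0 u hu) (hev0 w w.2) hmem (hmem1 w)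
      rw [← map_smul] at hc
      exact ⟨c, Subtype.ext (Subtype.ext (coeffsToFun_injective k hc).symm)⟩
    · push Not at hnxt
      rw [← Module.finrank_self F]
      apply LinearMap.finrank_le_finrank_of_injective
        (f := (LinearMap.proj nxt).comp (U.subtype.comp (LinearMap.ker ev).subtype))
      rw [injective_iff_map_eq_zero]
      exact fun w hw => Subtype.ext (hnxt w w.2 hw)
  have hsurj : LinearMap.range ev = ⊤ := by
    apply Submodule.eq_top_of_finrank_eq
    have h1 := LinearMap.finrank_range_add_finrank_ker ev
    have h2 := Submodule.finrank_le (LinearMap.range ev)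
    rw [Module.finrank_fintype_fun_eq_card, hcard] at h2 ⊢
    omega
  obtain ⟨u, hu⟩ := LinearMap.range_eq_top.1 hsurj y
  exact ⟨u, u.2, fun i => congrFun hu i⟩

/-- A word at distance at least `k - 1` from the residue code. -/
lemma exists_forall_le_hammingDist_of_mulVec_eq_zero [DecidableEq F]
    (hP : ∀ i, onCurve s t (P i)) (hinj : Function.Injective P) (hk : 2 ≤ k) (hkn : k < n) :
    ∃ v : Fin n → F, ∀ c, Hmat k P *ᵥ c = 0 → k - 1 ≤ hammingDist v c := by
  let top : Fin k := ⟨if k % 2 = 0 then k / 2 else k - 1, by split_ifs <;> omega⟩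
  obtain ⟨v, hv⟩ := mulVec_Hmat_surjective hP hinj hkn (Pi.single top 1)
  refine ⟨v, fun c hc => ?_⟩
  have hw : Hmat k P *ᵥ (v - c) = Pi.single top 1 := by
    rw [Matrix.mulVec_sub, hc, sub_zero]
    exact hv
  have hpos : 0 < hammingDist v c := hammingDist_pos.2 (by
    rintro rfl
    rw [sub_self, Matrix.mulVec_zero] at hw
    simpa using congrFun hw top)
  by_contra hlt
  have hsupp : (Finset.univ.filter fun i => v i ≠ c i).card ≤ k - 2 := by
    change hammingDist v c ≤ k - 2
    omega
  obtain ⟨S, hsub, -, hS⟩ := Finset.exists_subsuperset_card_eq (Finset.subset_univ _) hsupp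
    (by rw [Finset.card_univ, Fintype.card_fin]; omega)
  obtain ⟨i, hi⟩ := Function.ne_iff.1 (hammingDist_pos.1 hpos)
  have hiS : i ∈ S := hsub (by simpa using hi)
  obtain ⟨u, hu0, hu⟩ := exists_eq_zero_and_vecMul_eq hP hinj (by omega) hS (top := top) rfl
    (Pi.single ⟨i, hiS⟩ 1)
  have h1 : (u ᵥ* Hmat k P) ⬝ᵥ (v - c) = 0 := by
    rw [← Matrix.dotProduct_mulVec, hw, dotProduct_single, hu0, zero_mul]
  have h2 : (u ᵥ* Hmat k P) ⬝ᵥ (v - c) = v i - c i := by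
    rw [dotProduct, Finset.sum_eq_single i]
    · rw [hu ⟨i, hiS⟩, Pi.single_eq_same, one_mul, Pi.sub_apply]
    · intro j _ hj
      by_cases hjS : j ∈ S
      · rw [hu ⟨j, hjS⟩, Pi.single_eq_of_ne (by simpa using hj), zero_mul]
      · have : v j = c j := by
          by_contra h
          exact hjS (hsub (by simpa using h))
        simp [this]
    · simp
  exact hi (sub_eq_zero.1 (h2.symm.trans h1))

end EllipticCode


/-- For `2 ≤ k ≤ n−2`, if `C` is the residue elliptic code `C_Ω(D,kO)` or
the functional elliptic code `C_L(D,kO)`, then its covering radius is `n − dim(C) − 1` or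
`n − dim(C)`. -/
theorem covering_radius_two_options
    (F : Type) [Field F] [Fintype F] [DecidableEq F]
    (hq : Odd (Fintype.card F))
    (s t : F) (hdisc : 4 * s ^ 3 + 27 * t ^ 2 ≠ 0)
    {n : ℕ} (k : ℕ) (P : Fin n → F × F)
    (hPinj : Function.Injective P)
    (hPcurve : ∀ i, onCurve s t (P i))
    (hk2 : 2 ≤ k) (hkn : k ≤ n - 2)
    (C : Set (Fin n → F)) (hC : C = resCode k P ∨ C = funcCode k P) :
    covRad C = n - dimCode F C - 1 ∨ covRad C = n - dimCode F C := by
  have hlt : k < n := by omega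
  rcases hC with rfl | rfl
  · have hC : resCode k P = (LinearMap.ker (Hmat k P).mulVecLin : Set (Fin n → F)) := rfl
    obtain ⟨v, hv⟩ := exists_forall_le_hammingDist_of_mulVec_eq_zero hPcurve hPinj hk2 hlt
    rw [hC, dimCode, Submodule.span_eq]
    refine covRad_eq_of_forall_le_hammingDist _ v fun c hc => ?_
    rw [finrank_ker_mulVecLin_Hmat hPcurve hPinj hlt]
    have := hv c hc
    omega
  · have hC : funcCode k P = (LinearMap.range (Hmat k P).vecMulLinear : Set (Fin n → F)) := by
      ext v
      exact exists_congr fun u => eq_comm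
    obtain ⟨v, hv⟩ := exists_forall_le_hammingDist_vecMul hPcurve hPinj hk2
    rw [hC, dimCode, Submodule.span_eq]
    refine covRad_eq_of_forall_le_hammingDist _ v ?_
    rintro _ ⟨u, rfl⟩
    rw [finrank_range_vecMulLinear_Hmat hPcurve hPinj hlt]
    exact hv u
end
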